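/- (Step 4 of the proof of Theorem 2: CDF approximation under a locally Lipschitz conditional density.) With the setup in the context, for every t ≥ 0 and a ∈ ℝ: | P(|Y − a| ≤ t | X ∈ R) − ∫_{a−t}^{a+t} p(y | x) dy | ≤ 2 t · L · diam(R), where L = L_{K_t} is the Lipschitz constant associated with the compact set K_t = [a − t, a + t]. -/

import Mathlib

open MeasureTheory

/-- If `T` has density `p`, the probability of `T ∈ S` is the integral of `p` over `S`. -/
lemma toReal_measure_preimage_eq_setIntegral {Ω E : Type*} [MeasurableSpace Ω] [MeasureSpace E]
    {μ : Measure Ω} {T : Ω → E} (hT : Measurable T) {p : E → ℝ} (hpm : Measurable p)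
    (hp0 : ∀ z, 0 ≤ p z)
    (hdensity : μ.map T = volume.withDensity (fun z => ENNReal.ofReal (p z)))
    {S : Set E} (hS : MeasurableSet S) :
    (μ (T ⁻¹' S)).toReal = ∫ z in S, p z := by
  rw [← Measure.map_apply hT hS, hdensity, withDensity_apply _ hS,
    integral_eq_lintegral_of_nonneg_ae (.of_forall hp0) hpm.aestronglyMeasurable]

/-- The density of a random variable under a finite measure is integrable. -/
lemma integrable_of_map_eq_withDensity {Ω E : Type*} [MeasurableSpace Ω] [MeasureSpace E]
    {μ : Measure Ω} [IsFiniteMeasure μ] {T : Ω → E} {p : E → ℝ}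
    (hpm : Measurable p) (hp0 : ∀ z, 0 ≤ p z)
    (hdensity : μ.map T = volume.withDensity (fun z => ENNReal.ofReal (p z))) :
    Integrable p := by
  refine ⟨hpm.aestronglyMeasurable, ?_⟩
  rw [hasFiniteIntegral_iff_ofReal (.of_forall hp0), ← setLIntegral_univ,
    ← withDensity_apply _ MeasurableSet.univ, ← hdensity]
  exact measure_lt_top _ _

/-- If `f / ∫ f` and `g / ∫ g` differ by at most `C` on `[a - t, a + t]`, then the mass that `f`
gives to this interval differs from its prediction by `g` by at most `2 t C ∫ f`. -/
lemma abs_setIntegral_sub_mul_integral_le {f g : ℝ → ℝ} (hf : Integrable f) (hg : Integrable g)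
    (hf0 : ∀ y, 0 ≤ f y) {a t C : ℝ} (ht : 0 ≤ t)
    (hC : 0 < ∫ y, f y → ∀ y ∈ Set.Icc (a - t) (a + t),
      |f y / (∫ u, f u) - g y / ∫ u, g u| ≤ C) :
    |(∫ y in Set.Icc (a - t) (a + t), f y)
        - (∫ y in Set.Icc (a - t) (a + t), g y / ∫ u, g u) * ∫ y, f y|
      ≤ 2 * t * C * ∫ y, f y := by
  rcases (integral_nonneg hf0 : 0 ≤ ∫ y, f y).eq_or_lt with h0 | hpos
  · have hle : ∫ y in Set.Icc (a - t) (a + t), f y ≤ ∫ y, f y :=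
      setIntegral_le_integral hf (.of_forall hf0)
    have hge : 0 ≤ ∫ y in Set.Icc (a - t) (a + t), f y := integral_nonneg hf0
    have hzero : ∫ y in Set.Icc (a - t) (a + t), f y = 0 :=
      le_antisymm (hle.trans_eq h0.symm) hge
    simp [hzero, ← h0]
  · have hbound := norm_setIntegral_le_of_norm_le_const (μ := volume)
      (s := Set.Icc (a - t) (a + t)) (f := fun y => f y / (∫ u, f u) - g y / ∫ u, g u)
      measure_Icc_lt_top (hC hpos)
    rw [integral_sub (hf.div_const _).integrableOn (hg.div_const _).integrableOn,
      integral_div (∫ u, f u) f, Real.norm_eq_abs, Real.volume_real_Icc_of_le (by linarith)]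
      at hbound
    have hmul := mul_le_mul_of_nonneg_right hbound hpos.le
    rw [← abs_of_pos hpos, ← abs_mul, abs_of_pos hpos, sub_mul,
      div_mul_cancel₀ _ hpos.ne'] at hmul
    exact hmul.trans_eq (by ring)

/-- **Step 4 of the proof of Theorem 2: CDF approximation under a locally
Lipschitz conditional density.** Let `(X, Y) ∈ ℝ^d × ℝ` have joint Lebesgue density `p`,
marginal density `pX(z) = ∫ p(z,y) dy` and conditional density `pcond(y|z) = p(z,y)/pX(z)`.
Let `R` be a bounded measurable set with `P(X ∈ R) > 0`, `x ∈ R` with `pX(x) > 0`, and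
suppose the conditional density is `L`-Lipschitz in `z` (uniformly for
`y ∈ K_t = [a−t, a+t]`, `L = L_{K_t}`). Then for every `t ≥ 0` and `a ∈ ℝ`:
`|P(|Y − a| ≤ t | X ∈ R) − ∫_{a−t}^{a+t} pcond(y|x) dy| ≤ 2 t L diam(R)`. -/
theorem conditional_cdf_approximation
    {Ω : Type*} [MeasurableSpace Ω] (μ : Measure Ω) [IsProbabilityMeasure μ]
    (d : ℕ) (X : Ω → EuclideanSpace ℝ (Fin d)) (Y : Ω → ℝ)
    (hX : Measurable X) (hY : Measurable Y)
    (p : EuclideanSpace ℝ (Fin d) × ℝ → ℝ) (hpm : Measurable p) (hp0 : ∀ zy, 0 ≤ p zy)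
    (hdensity : Measure.map (fun ω => (X ω, Y ω)) μ
      = volume.withDensity (fun zy => ENNReal.ofReal (p zy)))
    (pX : EuclideanSpace ℝ (Fin d) → ℝ) (hpX : ∀ z, pX z = ∫ y, p (z, y))
    (pcond : ℝ → EuclideanSpace ℝ (Fin d) → ℝ)
    (hpcond : ∀ y z, pcond y z = p (z, y) / pX z)
    (R : Set (EuclideanSpace ℝ (Fin d))) (hRm : MeasurableSet R)
    (hRb : Bornology.IsBounded R) (hXR : 0 < μ (X ⁻¹' R))
    (x : EuclideanSpace ℝ (Fin d)) (hx : x ∈ R) (hpXx : 0 < pX x)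
    (a t L : ℝ) (ht : 0 ≤ t) (hL : 0 ≤ L)
    (hLip : ∀ z z', 0 < pX z → 0 < pX z' → ∀ y ∈ Set.Icc (a - t) (a + t),
      |pcond y z - pcond y z'| ≤ L * ‖z - z'‖) :
    |(μ ({ω | |Y ω - a| ≤ t} ∩ X ⁻¹' R)).toReal / (μ (X ⁻¹' R)).toReal
        - ∫ y in Set.Icc (a - t) (a + t), pcond y x|
      ≤ 2 * t * L * Metric.diam R := by
  set K := Set.Icc (a - t) (a + t) with hK
  have hXY : Measurable fun ω => (X ω, Y ω) := hX.prodMk hY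
  have hint : Integrable p := integrable_of_map_eq_withDensity hpm hp0 hdensity
  have hprob : ∀ S : Set ℝ, MeasurableSet S →
      (μ ((fun ω => (X ω, Y ω)) ⁻¹' R ×ˢ S)).toReal = ∫ z in R, ∫ y in S, p (z, y) := by
    intro S hS
    rw [toReal_measure_preimage_eq_setIntegral hXY hpm hp0 hdensity (hRm.prod hS)]
    exact setIntegral_prod p hint.integrableOn
  have hnum : (μ ({ω | |Y ω - a| ≤ t} ∩ X ⁻¹' R)).toReal = ∫ z in R, ∫ y in K, p (z, y) := by
    rw [← hprob K measurableSet_Icc]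
    congr 2
    ext ω
    simp only [Set.mem_inter_iff, Set.mem_ofPred_eq, Set.mem_preimage, Set.mem_prod, hK,
      Set.mem_Icc, abs_le]
    constructor
    · rintro ⟨⟨h₁, h₂⟩, h₃⟩
      exact ⟨h₃, by linarith, by linarith⟩
    · rintro ⟨h₃, h₁, h₂⟩
      exact ⟨⟨by linarith, by linarith⟩, h₃⟩
  have hden : (μ (X ⁻¹' R)).toReal = ∫ z in R, pX z := by
    have h := hprob Set.univ MeasurableSet.univ
    simp only [setIntegral_univ, ← hpX] at h
    rw [← h]
    congr 2
    ext ω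
    simp
  have hden_pos : 0 < ∫ z in R, pX z :=
    hden ▸ ENNReal.toReal_pos hXR.ne' (measure_ne_top _ _)
  have hpX_int : Integrable pX := by
    simpa only [← hpX] using Integrable.integral_prod_left hint
  have hK_int : IntegrableOn (fun z => ∫ y in K, p (z, y)) R := by
    have h : Integrable p ((volume.restrict R).prod (volume.restrict K)) := by
      rw [Measure.prod_restrict]
      exact hint.integrableOn
    exact h.integral_prod_left
  have hx_int : Integrable fun y => p (x, y) := by
    by_contra h
    rw [hpX, integral_undef h] at hpXx
    exact hpXx.false
  have hpointwise : ∀ᵐ z ∂volume.restrict R,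
      ‖(∫ y in K, p (z, y)) - (∫ y in K, pcond y x) * pX z‖
        ≤ 2 * t * (L * Metric.diam R) * pX z := by
    filter_upwards [ae_restrict_mem hRm, ae_restrict_of_ae (Integrable.prod_right_ae hint)]
      with z hz hz_int
    have h := abs_setIntegral_sub_mul_integral_le (a := a) (C := L * Metric.diam R)
      hz_int hx_int (fun y => hp0 (z, y)) ht ?_
    · simpa only [hpcond, hpX, Real.norm_eq_abs] using h
    · intro hpos y hy
      rw [← hpX] at hpos
      have hdist : ‖z - x‖ ≤ Metric.diam R := by
        rw [← dist_eq_norm]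
        exact Metric.dist_le_diam_of_mem hRb hz hx
      have h := (hLip z x hpos hpXx y hy).trans (mul_le_mul_of_nonneg_left hdist hL)
      simpa only [hpcond, hpX] using h
  have hmain := norm_integral_le_of_norm_le (hpX_int.integrableOn.const_mul _) hpointwise
  rw [integral_sub hK_int (hpX_int.integrableOn.const_mul _), integral_const_mul,
    integral_const_mul, Real.norm_eq_abs] at hmain
  rw [hnum, hden, div_sub' hden_pos.ne', abs_div, abs_of_pos hden_pos, div_le_iff₀ hden_pos,
    mul_comm (∫ z in R, pX z)]
  exact hmain.trans_eq (by ring)
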